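/- Let u be an ancient solution of the heat equation on ℝⁿ with polynomial growth of degree at most q, where q/2 is a positive integer, so that u(x,t) = u_0(x) + u_1(x) t + ⋯ + u_{q/2}(x) t^{q/2} with Δu_i = (i+1)u_{i+1} and Δu_{q/2} = 0. Then the top coefficient u_{q/2} is a bounded harmonic function on ℝⁿ, and hence is constant. -/

import Mathlib

open MeasureTheory Real

noncomputable section

/-- Spatial Laplacian of `f : ℝⁿ → ℝ` at `x` (sum of second partial derivatives). -/
def lap (n : ℕ) (f : EuclideanSpace ℝ (Fin n) → ℝ) (x : EuclideanSpace ℝ (Fin n)) : ℝ :=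
  ∑ i : Fin n, fderiv ℝ (fun y => fderiv ℝ f y (EuclideanSpace.single i 1)) x
    (EuclideanSpace.single i 1)

/-- `u` is a smooth ancient solution of the heat equation on `ℝⁿ × (-∞, 0]`:
it is smooth and satisfies `Δ_x u = ∂_t u` for all `t ≤ 0`. -/
def IsAncientHeat (n : ℕ) (u : EuclideanSpace ℝ (Fin n) × ℝ → ℝ) : Prop :=
  ContDiff ℝ (⊤ : ℕ∞) u ∧ ∀ (x : EuclideanSpace ℝ (Fin n)) (t : ℝ), t ≤ 0 →
    lap n (fun y => u (y, t)) x = deriv (fun s => u (x, s)) t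

/-- The derivative of `f` in the direction `e`, as a function of the point. -/
def dirDeriv {E : Type*} [NormedAddCommGroup E] [NormedSpace ℝ E] (e : E) (f : E → ℝ) (y : E) : ℝ :=
  fderiv ℝ f y e

section DirDeriv

variable {E : Type*} [NormedAddCommGroup E] [NormedSpace ℝ E] {a b f w : E → ℝ}

lemma contDiff_dirDeriv (hf : ContDiff ℝ (⊤ : ℕ∞) f) (e : E) :
    ContDiff ℝ (⊤ : ℕ∞) (dirDeriv e f) := by
  unfold dirDeriv
  exact (hf.fderiv_right (m := (⊤ : ℕ∞)) (by simp)).clm_apply contDiff_const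

lemma ContDiff.differentiable_of_top (hf : ContDiff ℝ (⊤ : ℕ∞) f) : Differentiable ℝ f :=
  hf.differentiable (by simp)

lemma dirDeriv_mul (ha : Differentiable ℝ a) (hb : Differentiable ℝ b) (e : E) :
    dirDeriv e (a * b) = a * dirDeriv e b + dirDeriv e a * b := by
  ext y
  simp [dirDeriv, fderiv_mul (ha y) (hb y), mul_comm]

lemma dirDeriv_add (ha : Differentiable ℝ a) (hb : Differentiable ℝ b) (e : E) :
    dirDeriv e (a + b) = dirDeriv e a + dirDeriv e b := by
  ext y
  simp [dirDeriv, fderiv_add (ha y) (hb y)]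

lemma dirDeriv_const_smul (ha : Differentiable ℝ a) (c : ℝ) (e : E) :
    dirDeriv e (c • a) = c • dirDeriv e a := by
  ext y
  simp [dirDeriv, fderiv_const_smul (ha y)]

lemma dirDeriv_sum {ι : Type*} {s : Finset ι} {F : ι → E → ℝ}
    (hF : ∀ i, Differentiable ℝ (F i)) (e : E) :
    dirDeriv e (∑ i ∈ s, F i) = ∑ i ∈ s, dirDeriv e (F i) := by
  ext y
  simp [dirDeriv, fderiv_sum fun i _ => hF i y]

lemma dirDeriv_dirDeriv_mul (ha : ContDiff ℝ (⊤ : ℕ∞) a) (hb : ContDiff ℝ (⊤ : ℕ∞) b) (e : E) :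
    dirDeriv e (dirDeriv e (a * b)) =
      a * dirDeriv e (dirDeriv e b) + 2 * (dirDeriv e a * dirDeriv e b)
        + dirDeriv e (dirDeriv e a) * b := by
  have ha' := (contDiff_dirDeriv ha e).differentiable_of_top
  have hb' := (contDiff_dirDeriv hb e).differentiable_of_top
  have ha := ha.differentiable_of_top
  have hb := hb.differentiable_of_top
  rw [dirDeriv_mul ha hb, dirDeriv_add (ha.mul hb') (ha'.mul hb), dirDeriv_mul ha hb',
    dirDeriv_mul ha' hb]
  ring

lemma dirDeriv_comm (hf : ContDiff ℝ (⊤ : ℕ∞) f) (d e : E) :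
    dirDeriv d (dirDeriv e f) = dirDeriv e (dirDeriv d f) := by
  have hf' : Differentiable ℝ (fderiv ℝ f) :=
    (hf.fderiv_right (m := (⊤ : ℕ∞)) (by simp)).differentiable (by simp)
  have key (d e y) : dirDeriv d (dirDeriv e f) y = fderiv ℝ (fderiv ℝ f) y d e := by
    change fderiv ℝ (fun z => fderiv ℝ f z e) y d = _
    rw [fderiv_clm_apply (hf' y) (differentiableAt_const e)]
    simp
  ext y
  rw [key, key]
  exact (hf.contDiffAt.isSymmSndFDerivAt (by
    rw [minSmoothness_of_isRCLikeNormedField]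
    exact WithTop.coe_le_coe.2 le_top)) d e

lemma deriv_line (hf : Differentiable ℝ f) (x e : E) :
    deriv (fun s : ℝ => f (x + s • e)) = fun s => dirDeriv e f (x + s • e) := by
  ext s
  have h : HasDerivAt (fun s : ℝ => x + s • e) e s := by
    simpa using ((hasDerivAt_id s).smul_const e).const_add x
  exact ((hf _).hasFDerivAt.comp_hasDerivAt s h).deriv

lemma deriv_deriv_nonpos_of_isLocalMax {φ : ℝ → ℝ} {s : ℝ} (hφ : IsLocalMax φ s)
    (hc : ContinuousAt φ s) : deriv (deriv φ) s ≤ 0 := by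
  by_contra! hpos
  have hmin := isLocalMin_of_deriv_deriv_pos hpos hφ.deriv_eq_zero hc
  have hconst : φ =ᶠ[nhds s] fun _ => φ s := by
    filter_upwards [hφ, hmin] with z h1 h2 using le_antisymm h1 h2
  have := hconst.deriv.deriv_eq
  simp [this] at hpos

lemma dirDeriv_dirDeriv_nonpos_of_isLocalMax (hw : ContDiff ℝ (⊤ : ℕ∞) w) {p : E}
    (hp : IsLocalMax w p) (e : E) : dirDeriv e (dirDeriv e w) p ≤ 0 := by
  have hline : Continuous fun s : ℝ => p + s • e := by fun_prop
  have hmax : IsLocalMax (fun s : ℝ => w (p + s • e)) 0 := by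
    have ht : Filter.Tendsto (fun s : ℝ => p + s • e) (nhds 0) (nhds p) := by
      simpa using hline.tendsto 0
    have := ht.eventually hp
    simpa [IsLocalMax, IsMaxFilter] using this
  have := deriv_deriv_nonpos_of_isLocalMax hmax (hw.continuous.comp hline).continuousAt
  rw [deriv_line hw.differentiable_of_top,
    deriv_line (contDiff_dirDeriv hw e).differentiable_of_top] at this
  simpa using this

end DirDeriv

section Cutoff

variable {E : Type*} [NormedAddCommGroup E] [InnerProductSpace ℝ E]

lemma dirDeriv_cutoff (r : ℝ) (x₀ e : E) :
    dirDeriv e (fun y => r ^ 2 - ‖y - x₀‖ ^ 2) = fun y => -2 * inner ℝ (y - x₀) e := by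
  ext y
  have h : HasFDerivAt (fun y : E => r ^ 2 - ‖y - x₀‖ ^ 2) _ y :=
    ((hasFDerivAt_id y).sub_const x₀).norm_sq.const_sub (r ^ 2)
  simp [dirDeriv, h.fderiv, inner_sub_left]

lemma dirDeriv_dirDeriv_cutoff (r : ℝ) (x₀ e : E) :
    dirDeriv e (dirDeriv e (fun y => r ^ 2 - ‖y - x₀‖ ^ 2)) = fun _ => -2 * ‖e‖ ^ 2 := by
  rw [dirDeriv_cutoff]
  ext y
  have h : HasFDerivAt (fun y : E => -2 * inner ℝ (y - x₀) e) _ y :=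
    (((hasFDerivAt_id y).sub_const x₀).inner ℝ (hasFDerivAt_const e y)).const_mul (-2)
  rw [dirDeriv, h.fderiv]
  simp

end Cutoff

section Liouville

variable {n : ℕ} {f : EuclideanSpace ℝ (Fin n) → ℝ}

lemma lap_eq_sum_dirDeriv (f : EuclideanSpace ℝ (Fin n) → ℝ) :
    lap n f = ∑ i, dirDeriv (EuclideanSpace.single i 1)
      (dirDeriv (EuclideanSpace.single i 1) f) := by
  ext x
  simp [lap, dirDeriv, Finset.sum_apply]
  rfl

lemma lap_dirDeriv (hf : ContDiff ℝ (⊤ : ℕ∞) f) (e : EuclideanSpace ℝ (Fin n)) :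
    lap n (dirDeriv e f) = dirDeriv e (lap n f) := by
  rw [lap_eq_sum_dirDeriv, lap_eq_sum_dirDeriv, dirDeriv_sum fun i =>
    (contDiff_dirDeriv (contDiff_dirDeriv hf _) _).differentiable_of_top]
  refine Finset.sum_congr rfl fun i _ => ?_
  rw [dirDeriv_comm hf _ e, dirDeriv_comm (contDiff_dirDeriv hf _) _ e]

/-- At an interior maximum of the Bernstein function `η² (∂ⱼf)² + λ f²`, where
`η = r² - |· - x₀|²`, the derivative `∂ⱼf` vanishes. -/
lemma bernstein_interior_max (hf : ContDiff ℝ (⊤ : ℕ∞) f) (hlap : lap n f = 0) (j : Fin n)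
    {r : ℝ} (hr : 0 < r) {x₀ p : EuclideanSpace ℝ (Fin n)} (hp : ‖p - x₀‖ < r)
    (hmax : IsLocalMax (fun y => (r ^ 2 - ‖y - x₀‖ ^ 2) ^ 2 *
        dirDeriv (EuclideanSpace.single j 1) f y ^ 2 + (13 + 2 * n) * r ^ 2 * f y ^ 2) p) :
    dirDeriv (EuclideanSpace.single j 1) f p = 0 := by
  set g := dirDeriv (EuclideanSpace.single j (1 : ℝ)) f with hg
  have hgs : ContDiff ℝ (⊤ : ℕ∞) g := contDiff_dirDeriv hf _
  have hglap : lap n g = 0 := by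
    rw [hg, lap_dirDeriv hf, hlap]
    ext y
    simp [dirDeriv]
  set η : EuclideanSpace ℝ (Fin n) → ℝ := fun y => r ^ 2 - ‖y - x₀‖ ^ 2 with hη
  have hηs : ContDiff ℝ (⊤ : ℕ∞) η :=
    contDiff_const.sub ((contDiff_id.sub contDiff_const).norm_sq ℝ)
  set c : ℝ := (13 + 2 * n) * r ^ 2 with hc
  have hw : (fun y => η y ^ 2 * g y ^ 2 + c * f y ^ 2) = (η * η) * (g * g) + c • (f * f) := by
    ext y
    simp
    ring
  rw [hw] at hmax
  have hA : ContDiff ℝ (⊤ : ℕ∞) (η * η * (g * g)) := (hηs.mul hηs).mul (hgs.mul hgs)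
  have hB : ContDiff ℝ (⊤ : ℕ∞) (f * f) := hf.mul hf
  have hB' : ContDiff ℝ (⊤ : ℕ∞) (c • (f * f)) := hB.const_smul c
  let e : Fin n → EuclideanSpace ℝ (Fin n) := fun i => EuclideanSpace.single i 1
  have hdir (i : Fin n) : 2 * η p ^ 2 * g p * dirDeriv (e i) (dirDeriv (e i) g) p
      + 2 * c * f p * dirDeriv (e i) (dirDeriv (e i) f) p + 2 * c * dirDeriv (e i) f p ^ 2
      - 24 * (p i - x₀ i) ^ 2 * g p ^ 2 - 4 * η p * g p ^ 2 ≤ 0 := by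
    have h := dirDeriv_dirDeriv_nonpos_of_isLocalMax
      (w := η * η * (g * g) + c • (f * f)) (hA.add hB') hmax (e i)
    have h1 : dirDeriv (e i) η p = -2 * (p i - x₀ i) := by
      rw [hη, dirDeriv_cutoff]
      simp [e, EuclideanSpace.inner_single_right]
    have h2 : dirDeriv (e i) (dirDeriv (e i) η) p = -2 := by
      rw [hη, dirDeriv_dirDeriv_cutoff]
      simp [e]
    rw [dirDeriv_add hA.differentiable_of_top hB'.differentiable_of_top,
      dirDeriv_const_smul hB.differentiable_of_top,
      dirDeriv_add (b := c • dirDeriv (e i) (f * f)) (contDiff_dirDeriv hA _).differentiable_of_top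
        ((contDiff_dirDeriv hB _).const_smul c).differentiable_of_top,
      dirDeriv_const_smul (contDiff_dirDeriv hB _).differentiable_of_top,
      dirDeriv_dirDeriv_mul (a := η * η) (b := g * g) (hηs.mul hηs) (hgs.mul hgs), dirDeriv_dirDeriv_mul hηs hηs,
      dirDeriv_dirDeriv_mul hgs hgs, dirDeriv_dirDeriv_mul hf hf,
      dirDeriv_mul hηs.differentiable_of_top hηs.differentiable_of_top,
      dirDeriv_mul hgs.differentiable_of_top hgs.differentiable_of_top] at h
    simp only [Pi.add_apply, Pi.mul_apply, Pi.smul_apply, smul_eq_mul, Pi.ofNat_apply, h1, h2] at h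
    nlinarith [h, sq_nonneg (η p * dirDeriv (e i) g p - 4 * (p i - x₀ i) * g p)]
  have hsum := Finset.sum_nonpos fun i (_ : i ∈ Finset.univ) => hdir i
  simp only [Finset.sum_sub_distrib, Finset.sum_add_distrib, ← Finset.mul_sum, ← Finset.sum_mul,
    Finset.sum_const, Finset.card_univ, Fintype.card_fin, nsmul_eq_mul] at hsum
  have hf0 : ∑ i, dirDeriv (e i) (dirDeriv (e i) f) p = 0 := by
    simpa [lap_eq_sum_dirDeriv] using congrFun hlap p
  have hg0 : ∑ i, dirDeriv (e i) (dirDeriv (e i) g) p = 0 := by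
    simpa [lap_eq_sum_dirDeriv] using congrFun hglap p
  have hnorm : ∑ i, (p i - x₀ i) ^ 2 = ‖p - x₀‖ ^ 2 := by
    simp [EuclideanSpace.real_norm_sq_eq]
  have hgle : g p ^ 2 ≤ ∑ i, dirDeriv (e i) f p ^ 2 :=
    Finset.single_le_sum (f := fun i => dirDeriv (e i) f p ^ 2) (fun i _ => sq_nonneg _)
      (Finset.mem_univ j)
  rw [hf0, hg0, hnorm] at hsum
  have hpr : ‖p - x₀‖ ^ 2 ≤ r ^ 2 := by gcongr
  have hηle : η p ≤ r ^ 2 := by simp [hη]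
  have hc0 : 0 ≤ c := by positivity
  have k1 : 2 * c * g p ^ 2 ≤ 2 * c * ∑ i, dirDeriv (e i) f p ^ 2 := by gcongr
  have k2 : 24 * ‖p - x₀‖ ^ 2 * g p ^ 2 ≤ 24 * r ^ 2 * g p ^ 2 := by gcongr
  have k3 : (n : ℝ) * (4 * η p * g p ^ 2) ≤ n * (4 * r ^ 2 * g p ^ 2) := by gcongr
  have k4 : r ^ 2 * g p ^ 2 ≤ 0 := by
    rw [hc] at k1 hsum
    linarith
  have k5 : g p ^ 2 ≤ 0 := nonpos_of_mul_nonpos_right k4 (by positivity)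
  exact pow_eq_zero_iff two_ne_zero |>.1 (le_antisymm k5 (sq_nonneg _))

/-- Bernstein's interior gradient estimate for a bounded harmonic function. -/
lemma bernstein_gradient_estimate (hf : ContDiff ℝ (⊤ : ℕ∞) f) (hlap : lap n f = 0) {M : ℝ}
    (hM : ∀ x, |f x| ≤ M) (j : Fin n) (x₀ : EuclideanSpace ℝ (Fin n)) {r : ℝ} (hr : 0 < r) :
    r ^ 2 * dirDeriv (EuclideanSpace.single j 1) f x₀ ^ 2 ≤ (13 + 2 * n) * M ^ 2 := by
  set g := dirDeriv (EuclideanSpace.single j (1 : ℝ)) f with hg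
  set w : EuclideanSpace ℝ (Fin n) → ℝ := fun y => (r ^ 2 - ‖y - x₀‖ ^ 2) ^ 2 *
        g y ^ 2 + (13 + 2 * n) * r ^ 2 * f y ^ 2 with hw
  have hgc : Continuous g := (contDiff_dirDeriv hf _).continuous
  have hfc : Continuous f := hf.continuous
  have hwc : Continuous w := by fun_prop
  obtain ⟨p, hpB, hp⟩ := (isCompact_closedBall x₀ r).exists_isMaxOn
    ⟨x₀, Metric.mem_closedBall_self hr.le⟩ hwc.continuousOn
  have hzero : (r ^ 2 - ‖p - x₀‖ ^ 2) ^ 2 * g p ^ 2 = 0 := by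
    rw [mem_closedBall_iff_norm] at hpB
    rcases hpB.eq_or_lt with h | h
    · simp [h]
    · have hloc : IsLocalMax w p := hp.isLocalMax <| Filter.mem_of_superset
        (Metric.isOpen_ball.mem_nhds (mem_ball_iff_norm.2 h)) Metric.ball_subset_closedBall
      simp [hg, bernstein_interior_max hf hlap j hr h hloc]
  have hle : w x₀ ≤ w p := hp (Metric.mem_closedBall_self hr.le)
  have hfp : f p ^ 2 ≤ M ^ 2 := sq_le_sq' (neg_le_of_abs_le (hM p)) (le_of_abs_le (hM p))
  have h1 : (13 + 2 * n) * r ^ 2 * f p ^ 2 ≤ (13 + 2 * n) * r ^ 2 * M ^ 2 := by gcongr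
  have h2 : 0 ≤ (13 + 2 * n) * r ^ 2 * f x₀ ^ 2 := by positivity
  simp only [hw, hzero, sub_self, norm_zero] at hle
  refine le_of_mul_le_mul_left (a := r ^ 2) ?_ (by positivity)
  linarith

/-- Liouville's theorem: a bounded smooth harmonic function on `ℝⁿ` is constant. -/
theorem liouville_of_bounded_harmonic (hf : ContDiff ℝ (⊤ : ℕ∞) f) (hlap : lap n f = 0) {M : ℝ}
    (hM : ∀ x, |f x| ≤ M) (x : EuclideanSpace ℝ (Fin n)) : f x = f 0 := by
  refine is_const_of_fderiv_eq_zero hf.differentiable_of_top (fun y => ?_) x 0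
  have hzero (j : Fin n) : fderiv ℝ f y (EuclideanSpace.single j 1) = 0 := by
    by_contra h
    have hpos : 0 < dirDeriv (EuclideanSpace.single j 1) f y ^ 2 := sq_pos_of_ne_zero h
    have hlim : Filter.Tendsto (fun r : ℝ => r ^ 2 * dirDeriv (EuclideanSpace.single j 1) f y ^ 2)
        Filter.atTop Filter.atTop :=
      (Filter.tendsto_pow_atTop two_ne_zero).atTop_mul_const hpos
    obtain ⟨r, hr, hr0⟩ := ((hlim.eventually_gt_atTop ((13 + 2 * n) * M ^ 2)).and
      (Filter.eventually_gt_atTop 0)).exists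
    exact (bernstein_gradient_estimate hf hlap hM j y hr0).not_gt hr
  ext z
  have hz := (EuclideanSpace.basisFun (Fin n) ℝ).sum_repr z
  rw [← hz]
  simp [hzero]

end Liouville

lemma abs_top_coefficient_le {m : ℕ} {c d : ℝ} {v : ℕ → ℝ}
    (h : ∀ t : ℝ, t ≤ 0 →
      |∑ i ∈ Finset.range (m + 1), v i * t ^ i| ≤ c * (d + √|t| + 1) ^ (2 * m)) :
    |v m| ≤ c := by
  have hpos (r : ℝ) (hr : 0 < r) :
      |∑ i ∈ Finset.range (m + 1), v i * (-1) ^ i * r ^ (2 * (m - i))|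
        ≤ c * ((d + 1) * r + 1) ^ (2 * m) := by
    have h0 := h (-(r⁻¹ ^ 2)) (by simp [sq_nonneg])
    rw [abs_neg, abs_of_nonneg (sq_nonneg r⁻¹), sqrt_sq (by positivity)] at h0
    have h1 := mul_le_mul_of_nonneg_right h0 (show 0 ≤ r ^ (2 * m) by positivity)
    rw [mul_assoc, ← mul_pow, ← abs_of_nonneg (show 0 ≤ r ^ (2 * m) by positivity), ← abs_mul,
      Finset.sum_mul] at h1
    have hsum : ∑ i ∈ Finset.range (m + 1), v i * (-1) ^ i * r ^ (2 * (m - i)) =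
        ∑ i ∈ Finset.range (m + 1), v i * (-(r⁻¹ ^ 2)) ^ i * r ^ (2 * m) := by
      refine Finset.sum_congr rfl fun i hi => ?_
      obtain ⟨k, rfl⟩ := Nat.exists_eq_add_of_le (Finset.mem_range_succ_iff.1 hi)
      rw [neg_pow (r⁻¹ ^ 2), mul_add 2 i k, pow_add, pow_mul r 2 i, Nat.add_sub_cancel_left]
      have hcancel : (r⁻¹ ^ 2) ^ i * (r ^ 2) ^ i = 1 := by
        rw [← mul_pow, ← mul_pow, inv_mul_cancel₀ hr.ne', one_pow, one_pow]
      linear_combination -(v i * (-1) ^ i * r ^ (2 * k)) * hcancel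
    have hbase : (d + 1) * r + 1 = (d + r⁻¹ + 1) * r := by
      field_simp
      ring
    rwa [hsum, hbase]
  have hL : Continuous fun r : ℝ =>
      |∑ i ∈ Finset.range (m + 1), v i * (-1) ^ i * r ^ (2 * (m - i))| := by fun_prop
  have hR : Continuous fun r : ℝ => c * ((d + 1) * r + 1) ^ (2 * m) := by fun_prop
  have hlim := le_of_tendsto_of_tendsto ((hL.tendsto 0).mono_left nhdsWithin_le_nhds)
    ((hR.tendsto 0).mono_left nhdsWithin_le_nhds)
    (Filter.eventually_of_mem (self_mem_nhdsWithin (s := Set.Ioi (0 : ℝ))) hpos)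
  have hlow : ∑ i ∈ Finset.range m, v i * (-1) ^ i * (0 : ℝ) ^ (2 * (m - i)) = 0 := by
    refine Finset.sum_eq_zero fun i hi => ?_
    have := Finset.mem_range.1 hi
    rw [zero_pow (by omega), mul_zero]
  rw [Finset.sum_range_succ, hlow] at hlim
  simpa [abs_mul] using hlim

/-- if `u` is an ancient solution of polynomial growth of degree at most
`q = 2m` (with `q/2 = m` a positive integer), written as
`u(x,t) = u₀(x) + u₁(x) t + ⋯ + u_m(x) t^m` with `Δ u_i = (i+1) u_{i+1}` and
`Δ u_m = 0`, then the top coefficient `u_m` is a bounded harmonic function on `ℝⁿ`,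
hence constant. -/
theorem ancient_poly_growth_top_coefficient_constant (n m : ℕ) (hm : 1 ≤ m)
    (c₀ : ℝ) (hc₀ : 0 < c₀)
    (u : EuclideanSpace ℝ (Fin n) × ℝ → ℝ)
    (hu : IsAncientHeat n u)
    (hgr : ∀ (x : EuclideanSpace ℝ (Fin n)) (t : ℝ), t ≤ 0 →
      |u (x, t)| ≤ c₀ * (‖x‖ + Real.sqrt |t| + 1) ^ (2 * m))
    (v : ℕ → EuclideanSpace ℝ (Fin n) → ℝ)
    (hsm : ∀ i, ContDiff ℝ (⊤ : ℕ∞) (v i))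
    (hrep : ∀ (x : EuclideanSpace ℝ (Fin n)) (t : ℝ), t ≤ 0 →
      u (x, t) = ∑ i ∈ Finset.range (m + 1), v i x * t ^ i)
    (hlap : ∀ i : ℕ, i < m → ∀ x, lap n (v i) x = ((i : ℝ) + 1) * v (i + 1) x)
    (htop : ∀ x, lap n (v m) x = 0) :
    (∃ M : ℝ, ∀ x, |v m x| ≤ M) ∧ ∃ c : ℝ, ∀ x, v m x = c := by
  have hM (x : EuclideanSpace ℝ (Fin n)) : |v m x| ≤ c₀ :=
    abs_top_coefficient_le (v := fun i => v i x) (d := ‖x‖) fun t ht =>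
      hrep x t ht ▸ hgr x t ht
  exact ⟨⟨c₀, hM⟩, v m 0, liouville_of_bounded_harmonic (hsm m) (funext htop) hM⟩
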